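/- arXiv:1507.05480 — 4 statements merged into one kernel-verified Lean document; each statement's English description precedes it below -/
import Mathlib

section
/- (Weighted Grioli theorem for the classical parameter range.) Let n ≥ 2, let F ∈ GL⁺(n), and let μ, μc ∈ ℝ with μc ≥ μ > 0. Then polar(F) is the unique minimizer of R ↦ W_{μ,μc}(R;F) over SO(n): for every R ∈ SO(n), W_{μ,μc}(R;F) ≥ W_{μ,μc}(polar(F);F), with equality if and only if R = polar(F). -/
open Matrix Real

noncomputable section

/-- Squared Frobenius norm: `‖X‖² = tr (Xᵀ X)`. -/
def frobSq {n : ℕ} (X : Matrix (Fin n) (Fin n) ℝ) : ℝ := Matrix.trace (Xᵀ * X)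

/-- The special orthogonal group as a set of matrices. -/
def SO (n : ℕ) : Set (Matrix (Fin n) (Fin n) ℝ) := {R | Rᵀ * R = 1 ∧ R.det = 1}

/-- Symmetric part of a matrix. -/
def symPart {n : ℕ} (X : Matrix (Fin n) (Fin n) ℝ) : Matrix (Fin n) (Fin n) ℝ :=
  (1 / 2 : ℝ) • (X + Xᵀ)

/-- Skew-symmetric part of a matrix. -/
def skewPart {n : ℕ} (X : Matrix (Fin n) (Fin n) ℝ) : Matrix (Fin n) (Fin n) ℝ :=
  (1 / 2 : ℝ) • (X - Xᵀ)

/-- The Cosserat shear-stretch energy `W_{μ,μc}(R; F)`. -/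
def W (μ μc : ℝ) {n : ℕ} (R F : Matrix (Fin n) (Fin n) ℝ) : ℝ :=
  μ * frobSq (symPart (Rᵀ * F - 1)) + μc * frobSq (skewPart (Rᵀ * F - 1))

/-- The planar rotation by angle `α`. -/
def rot (α : ℝ) : Matrix (Fin 2) (Fin 2) ℝ :=
  !![Real.cos α, -Real.sin α; Real.sin α, Real.cos α]


lemma frobSq_nonneg {n : ℕ} (X : Matrix (Fin n) (Fin n) ℝ) : 0 ≤ frobSq X := by
  simpa [frobSq] using (Matrix.posSemidef_conjTranspose_mul_self X).trace_nonneg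

/-- The symmetric and skew-symmetric parts are orthogonal. -/
lemma frobSq_symPart_add_frobSq_skewPart {n : ℕ} (X : Matrix (Fin n) (Fin n) ℝ) :
    frobSq (symPart X) + frobSq (skewPart X) = frobSq X := by
  have h : (X * Xᵀ).trace = (Xᵀ * X).trace := Matrix.trace_mul_comm _ _
  simp only [frobSq, symPart, skewPart, transpose_smul, transpose_add, transpose_sub,
    transpose_transpose, smul_mul_smul_comm, trace_smul, mul_add, add_mul, mul_sub, sub_mul,
    trace_add, trace_sub, smul_eq_mul, h]
  ring

lemma frobSq_transpose_mul_sub_one {n : ℕ} {R : Matrix (Fin n) (Fin n) ℝ} (hR : Rᵀ * R = 1)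
    (F : Matrix (Fin n) (Fin n) ℝ) :
    frobSq (Rᵀ * F - 1) = (Fᵀ * F).trace - 2 * (Rᵀ * F).trace + n := by
  have hR' : R * Rᵀ = 1 := mul_eq_one_comm.mp hR
  have h1 : Fᵀ * R * (Rᵀ * F) = Fᵀ * F := by
    rw [Matrix.mul_assoc, ← Matrix.mul_assoc R, hR', Matrix.one_mul]
  have h2 : (Fᵀ * R).trace = (Rᵀ * F).trace := by
    rw [← Matrix.trace_transpose, transpose_mul, transpose_transpose]
  simp only [frobSq, transpose_sub, transpose_mul, transpose_transpose, transpose_one, mul_sub,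
    sub_mul, Matrix.mul_one, Matrix.one_mul, trace_sub, h1, h2, trace_one, Fintype.card_fin]
  ring

lemma W_eq_frobSq_add_frobSq_skewPart {n : ℕ} (μ μc : ℝ) (R F : Matrix (Fin n) (Fin n) ℝ) :
    W μ μc R F = μ * frobSq (Rᵀ * F - 1) + (μc - μ) * frobSq (skewPart (Rᵀ * F - 1)) := by
  rw [W, ← frobSq_symPart_add_frobSq_skewPart (Rᵀ * F - 1)]
  ring

/-- The excess energy over an orthogonal polar factor `P` of `F = P * U`. -/
lemma W_sub_W_polar {n : ℕ} (μ μc : ℝ) {R P U : Matrix (Fin n) (Fin n) ℝ} (hR : Rᵀ * R = 1)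
    (hP : Pᵀ * P = 1) (hU : Uᵀ = U) :
    W μ μc R (P * U) - W μ μc P (P * U) =
      μ * ((1 - Rᵀ * P) * U * (1 - Rᵀ * P)ᵀ).trace
        + (μc - μ) * frobSq (skewPart (Rᵀ * (P * U) - 1)) := by
  have hPU : Pᵀ * (P * U) = U := by rw [← Matrix.mul_assoc, hP, Matrix.one_mul]
  have hskew : skewPart (U - 1) = 0 := by simp [skewPart, hU]
  have h1 : (U * (Pᵀ * R)).trace = (Rᵀ * (P * U)).trace := by
    rw [← Matrix.trace_transpose]
    simp [hU, Matrix.mul_assoc]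
  have h2 : (Rᵀ * (P * (U * (Pᵀ * R)))).trace = U.trace := by
    rw [Matrix.trace_mul_comm]
    simp only [Matrix.mul_assoc, mul_eq_one_comm.mp hR, Matrix.mul_one]
    rw [Matrix.trace_mul_comm, Matrix.mul_assoc, hP, Matrix.mul_one]
  have htr : ((1 - Rᵀ * P) * U * (1 - Rᵀ * P)ᵀ).trace
      = 2 * U.trace - 2 * (Rᵀ * (P * U)).trace := by
    simp only [transpose_sub, transpose_mul, transpose_transpose, transpose_one, mul_sub,
      sub_mul, Matrix.mul_one, Matrix.one_mul, trace_sub, Matrix.mul_assoc, h1, h2]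
    ring
  rw [W_eq_frobSq_add_frobSq_skewPart, W_eq_frobSq_add_frobSq_skewPart μ μc P,
    frobSq_transpose_mul_sub_one hR, frobSq_transpose_mul_sub_one hP, hPU, hskew, htr]
  simp only [frobSq, Matrix.mul_zero, trace_zero]
  ring

lemma trace_mul_posDef_mul_transpose_eq_zero {n : ℕ} {N U : Matrix (Fin n) (Fin n) ℝ}
    (hU : U.PosDef) (h : (N * U * Nᵀ).trace = 0) : N = 0 := by
  have hzero : N * U * Nᵀ = 0 := by
    have := hU.posSemidef.mul_mul_conjTranspose_same N
    rw [conjTranspose_eq_transpose_of_trivial] at this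
    exact this.trace_eq_zero_iff.mp h
  have hNt : Nᵀ = 0 := by
    refine Matrix.ext_of_mulVec_single fun i => ?_
    rw [Matrix.zero_mulVec]
    by_contra hne
    have hpos := hU.dotProduct_mulVec_pos hne
    have heq := congrArg (fun A => Pi.single i (1 : ℝ) ⬝ᵥ A *ᵥ Pi.single i (1 : ℝ)) hzero
    simp only [Matrix.zero_mulVec, dotProduct_zero, ← Matrix.mulVec_mulVec] at heq
    rw [Matrix.dotProduct_mulVec, ← Matrix.mulVec_transpose] at heq
    simp only [star_trivial] at hpos
    exact hpos.ne' heq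
  simpa using congrArg transpose hNt

/-- **Weighted Grioli theorem, classical range μc ≥ μ > 0.** The polar factor
polar(F) = F · U(F)⁻¹ is the unique minimizer of R ↦ W_{μ,μc}(R;F) over SO(n). -/
theorem weighted_grioli_classical (n : ℕ) (hn : 2 ≤ n)
    (F : Matrix (Fin n) (Fin n) ℝ) (hF : 0 < F.det)
    (U : Matrix (Fin n) (Fin n) ℝ) (hUpos : U.PosDef) (hUsq : U * U = Fᵀ * F)
    (μ μc : ℝ) (hμ : 0 < μ) (hμc : μ ≤ μc) :
    (∀ R ∈ SO n, W μ μc (F * U⁻¹) F ≤ W μ μc R F) ∧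
    (∀ R ∈ SO n, W μ μc R F = W μ μc (F * U⁻¹) F ↔ R = F * U⁻¹) := by
  have hUt : Uᵀ = U := by simpa using hUpos.isHermitian.eq
  have hdet : IsUnit U.det := hUpos.det_pos.ne'.isUnit
  have hPU : F * U⁻¹ * U = F := Matrix.nonsing_inv_mul_cancel_right _ _ hdet
  have hP : (F * U⁻¹)ᵀ * (F * U⁻¹) = 1 := by
    rw [transpose_mul, transpose_nonsing_inv, hUt, Matrix.mul_assoc, ← Matrix.mul_assoc Fᵀ,
      ← hUsq, Matrix.mul_assoc, Matrix.mul_nonsing_inv _ hdet, Matrix.mul_one,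
      Matrix.nonsing_inv_mul _ hdet]
  have key : ∀ R ∈ SO n, W μ μc R F - W μ μc (F * U⁻¹) F =
      μ * ((1 - Rᵀ * (F * U⁻¹)) * U * (1 - Rᵀ * (F * U⁻¹))ᵀ).trace
        + (μc - μ) * frobSq (skewPart (Rᵀ * F - 1)) := fun R hR => by
    simpa only [hPU] using W_sub_W_polar μ μc hR.1 hP hUt
  have htr : ∀ N : Matrix (Fin n) (Fin n) ℝ, 0 ≤ (N * U * Nᵀ).trace := fun N => by
    simpa using (hUpos.posSemidef.mul_mul_conjTranspose_same N).trace_nonneg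
  have hskew : ∀ R : Matrix (Fin n) (Fin n) ℝ,
      0 ≤ (μc - μ) * frobSq (skewPart (Rᵀ * F - 1)) := fun R =>
    mul_nonneg (sub_nonneg.mpr hμc) (frobSq_nonneg _)
  refine ⟨fun R hR => ?_, fun R hR => ⟨fun h => ?_, fun h => by rw [h]⟩⟩
  · linarith [key R hR, hskew R, mul_nonneg hμ.le (htr (1 - Rᵀ * (F * U⁻¹)))]
  · have hzero : ((1 - Rᵀ * (F * U⁻¹)) * U * (1 - Rᵀ * (F * U⁻¹))ᵀ).trace = 0 := by
      nlinarith [key R hR, hskew R, htr (1 - Rᵀ * (F * U⁻¹))]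
    have hN := sub_eq_zero.mp (trace_mul_posDef_mul_transpose_eq_zero hUpos hzero)
    calc R = R * (Rᵀ * (F * U⁻¹)) := by rw [← hN, Matrix.mul_one]
      _ = F * U⁻¹ := by rw [← Matrix.mul_assoc, mul_eq_one_comm.mp hR.1, Matrix.one_mul]
end
end

section
/- (The formally reduced energy W_{1,0}^red.) Let F ∈ GL⁺(2). Then min_{R ∈ SO(2)} W_{1,0}(R;F) equals ‖U(F) − 𝟙‖² if tr U(F) < 2, and equals (1/2)‖F‖² − det F if tr U(F) ≥ 2. -/
open Matrix Real

noncomputable section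

lemma frobSq_fin_two (X : Matrix (Fin 2) (Fin 2) ℝ) :
    frobSq X = X 0 0 ^ 2 + X 0 1 ^ 2 + X 1 0 ^ 2 + X 1 1 ^ 2 := by
  simp [frobSq, Matrix.trace_fin_two, Matrix.mul_apply, Fin.sum_univ_two]
  ring

lemma mem_SO_two_iff {R : Matrix (Fin 2) (Fin 2) ℝ} :
    R ∈ SO 2 ↔ R 1 1 = R 0 0 ∧ R 0 1 = -R 1 0 ∧ R 0 0 ^ 2 + R 1 0 ^ 2 = 1 := by
  have h_iff : R ∈ SO 2 ↔ Rᵀ * R = 1 ∧ R.det = 1 := Iff.rfl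
  rw [h_iff, ← Matrix.ext_iff, Matrix.det_fin_two]
  simp only [Fin.forall_fin_two, Matrix.mul_apply, Fin.sum_univ_two, Matrix.transpose_apply,
    Matrix.one_apply, Fin.isValue, if_true, zero_ne_one, one_ne_zero, if_false]
  constructor
  · rintro ⟨⟨⟨h₀₀, h₀₁⟩, h₁₀, h₁₁⟩, hdet⟩
    refine ⟨?_, ?_, by linarith⟩
    · linear_combination R 0 0 * hdet + R 1 0 * h₀₁ - R 1 1 * h₀₀
    · linear_combination R 0 0 * h₀₁ - R 0 1 * h₀₀ - R 1 0 * hdet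
  · rintro ⟨h₁, h₂, h₃⟩
    rw [h₁, h₂]
    refine ⟨⟨⟨?_, ?_⟩, ?_, ?_⟩, ?_⟩ <;> linarith

lemma trace_transpose_mul_of_mem_SO_two {R : Matrix (Fin 2) (Fin 2) ℝ} (hR : R ∈ SO 2)
    (F : Matrix (Fin 2) (Fin 2) ℝ) :
    (Rᵀ * F).trace = R 0 0 * (F 0 0 + F 1 1) + R 1 0 * (F 1 0 - F 0 1) := by
  obtain ⟨h₁, h₂, -⟩ := mem_SO_two_iff.1 hR
  simp only [Matrix.trace_fin_two, Matrix.mul_apply, Fin.sum_univ_two, Matrix.transpose_apply,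
    h₁, h₂]
  ring

/-- On `SO(2)`, the energy with `μ = 1` and `μc = 0` depends on `R` only through `tr (Rᵀ F)`. -/
lemma W_one_zero_of_mem_SO_two {R : Matrix (Fin 2) (Fin 2) ℝ} (hR : R ∈ SO 2)
    (F : Matrix (Fin 2) (Fin 2) ℝ) :
    W 1 0 R F = (1 / 2) * frobSq F - F.det + (1 / 2) * ((Rᵀ * F).trace - 2) ^ 2 := by
  rw [trace_transpose_mul_of_mem_SO_two hR]
  obtain ⟨h₁, h₂, h₃⟩ := mem_SO_two_iff.1 hR
  simp only [W, symPart, frobSq_fin_two, Matrix.det_fin_two, Matrix.smul_apply, Matrix.add_apply,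
    Matrix.sub_apply, Matrix.transpose_apply, Matrix.mul_apply, Fin.sum_univ_two, Matrix.one_apply,
    Fin.isValue, if_true, zero_ne_one, one_ne_zero, if_false, smul_eq_mul, h₁, h₂]
  linear_combination (1 / 2 * ((F 0 0 - F 1 1) ^ 2 + (F 0 1 + F 1 0) ^ 2)) * h₃

lemma trace_transpose_mul_sq_le {R : Matrix (Fin 2) (Fin 2) ℝ} (hR : R ∈ SO 2)
    (F : Matrix (Fin 2) (Fin 2) ℝ) :
    (Rᵀ * F).trace ^ 2 ≤ frobSq F + 2 * F.det := by
  rw [trace_transpose_mul_of_mem_SO_two hR, frobSq_fin_two, Matrix.det_fin_two]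
  obtain ⟨-, -, h₃⟩ := mem_SO_two_iff.1 hR
  have key := sq_nonneg (R 0 0 * (F 1 0 - F 0 1) - R 1 0 * (F 0 0 + F 1 1))
  linear_combination key + ((F 0 0 + F 1 1) ^ 2 + (F 1 0 - F 0 1) ^ 2) * h₃

lemma exists_mem_SO_two_trace_eq {F : Matrix (Fin 2) (Fin 2) ℝ} {τ : ℝ}
    (hF : 0 < frobSq F + 2 * F.det) (hτ : τ ^ 2 ≤ frobSq F + 2 * F.det) :
    ∃ R ∈ SO 2, (Rᵀ * F).trace = τ := by
  have hs : frobSq F + 2 * F.det = (F 0 0 + F 1 1) ^ 2 + (F 1 0 - F 0 1) ^ 2 := by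
    rw [frobSq_fin_two, Matrix.det_fin_two]
    ring
  rw [hs] at hF hτ
  set p := F 0 0 + F 1 1 with hp
  set q := F 1 0 - F 0 1 with hq
  obtain ⟨r, hr⟩ : ∃ r : ℝ, r ^ 2 = p ^ 2 + q ^ 2 - τ ^ 2 := ⟨_, Real.sq_sqrt (sub_nonneg.2 hτ)⟩
  have hne := hF.ne'
  let x := (τ * p - r * q) / (p ^ 2 + q ^ 2)
  let y := (τ * q + r * p) / (p ^ 2 + q ^ 2)
  have hR : !![x, -y; y, x] ∈ SO 2 := by
    rw [mem_SO_two_iff]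
    refine ⟨rfl, rfl, ?_⟩
    change x ^ 2 + y ^ 2 = 1
    simp only [x, y]
    field_simp
    linear_combination (p ^ 2 + q ^ 2) * hr
  refine ⟨_, hR, ?_⟩
  rw [trace_transpose_mul_of_mem_SO_two hR, ← hp, ← hq]
  change x * p + y * q = τ
  simp only [x, y]
  field_simp
  ring

/-- The trace of a two-dimensional right stretch tensor: `(tr U)² = ‖F‖² + 2 det F`. -/
lemma trace_sq_of_mul_self_eq {F U : Matrix (Fin 2) (Fin 2) ℝ} (hF : 0 < F.det)
    (hUpos : U.PosDef) (hUsq : U * U = Fᵀ * F) :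
    U.trace ^ 2 = frobSq F + 2 * F.det := by
  have hdet : U.det = F.det := by
    have h := congrArg Matrix.det hUsq
    rw [Matrix.det_mul, Matrix.det_mul, Matrix.det_transpose] at h
    exact (mul_self_inj hUpos.det_pos.le hF.le).1 h
  have htr : (U * U).trace = frobSq F := congrArg Matrix.trace hUsq
  rw [← hdet, ← htr]
  simp only [Matrix.trace_fin_two, Matrix.det_fin_two, Matrix.mul_apply, Fin.sum_univ_two]
  ring

lemma frobSq_sub_one_of_mul_self_eq {F U : Matrix (Fin 2) (Fin 2) ℝ} (hUsymm : Uᵀ = U)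
    (hUsq : U * U = Fᵀ * F) :
    frobSq (U - 1) = frobSq F - 2 * U.trace + 2 := by
  rw [frobSq, frobSq, ← hUsq, Matrix.transpose_sub, hUsymm, Matrix.transpose_one]
  simp [sub_mul, mul_sub]
  ring

/-- **The formally reduced energy W_{1,0}^red.** min_{R ∈ SO(2)} W_{1,0}(R;F)
equals ‖U(F) − 𝟙‖² if tr U(F) < 2 and (1/2)‖F‖² − det F if tr U(F) ≥ 2. -/
theorem reduced_energy_W10 (F : Matrix (Fin 2) (Fin 2) ℝ) (hF : 0 < F.det)
    (U : Matrix (Fin 2) (Fin 2) ℝ) (hUpos : U.PosDef) (hUsq : U * U = Fᵀ * F) :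
    (Matrix.trace U < 2 →
      IsLeast ((fun R => W 1 0 R F) '' SO 2) (frobSq (U - 1))) ∧
    (2 ≤ Matrix.trace U →
      IsLeast ((fun R => W 1 0 R F) '' SO 2) ((1 / 2) * frobSq F - F.det)) := by
  have hs := trace_sq_of_mul_self_eq hF hUpos hUsq
  have hpos : 0 < U.trace := hUpos.trace_pos
  have hpos' : 0 < frobSq F + 2 * F.det := hs ▸ pow_pos hpos 2
  constructor
  · intro hlt
    have hUsymm : Uᵀ = U := by simpa using hUpos.isHermitian.eq
    rw [frobSq_sub_one_of_mul_self_eq hUsymm hUsq]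
    constructor
    · obtain ⟨R, hR, ht⟩ := exists_mem_SO_two_trace_eq hpos' hs.le
      refine ⟨R, hR, ?_⟩
      change W 1 0 R F = _
      rw [W_one_zero_of_mem_SO_two hR, ht]
      linear_combination (1 / 2) * hs
    · rintro _ ⟨R, hR, rfl⟩
      change _ ≤ W 1 0 R F
      rw [W_one_zero_of_mem_SO_two hR]
      have hle : (Rᵀ * F).trace ≤ U.trace :=
        (abs_le_of_sq_le_sq' (hs ▸ trace_transpose_mul_sq_le hR F) hpos.le).2
      nlinarith
  · intro hge
    constructor
    · obtain ⟨R, hR, ht⟩ := exists_mem_SO_two_trace_eq (τ := 2) hpos' (by nlinarith)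
      refine ⟨R, hR, ?_⟩
      change W 1 0 R F = _
      rw [W_one_zero_of_mem_SO_two hR, ht]
      ring
    · rintro _ ⟨R, hR, rfl⟩
      change _ ≤ W 1 0 R F
      rw [W_one_zero_of_mem_SO_two hR]
      exact le_add_of_nonneg_right (by positivity)
end
end

section
/- (Optimal planar Cosserat rotations for general non-classical parameters.) Let F ∈ GL⁺(2), let μ, μc ∈ ℝ with μ > μc ≥ 0, and set ρ := 2μ/(μ − μc). If tr U(F) < ρ, then the set of minimizers of R ↦ W_{μ,μc}(R;F) over SO(2) equals {polar(F)}. If tr U(F) ≥ ρ, then, setting β := arccos(ρ/tr U(F)), the set of minimizers of R ↦ W_{μ,μc}(R;F) over SO(2) equals {polar(F)·R(β), polar(F)·R(−β)}. -/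
open Matrix Real

noncomputable section

theorem rot_mem_SO (α : ℝ) : rot α ∈ SO 2 := by
  refine ⟨?_, ?_⟩
  · ext i j
    fin_cases i <;> fin_cases j <;> simp [rot, Matrix.mul_apply, Fin.sum_univ_two] <;>
      nlinarith [Real.sin_sq_add_cos_sq α]
  · rw [rot, Matrix.det_fin_two_of]
    nlinarith [Real.sin_sq_add_cos_sq α]

theorem SO.mul_mem {n : ℕ} {P Q : Matrix (Fin n) (Fin n) ℝ} (hP : P ∈ SO n) (hQ : Q ∈ SO n) :
    P * Q ∈ SO n := by
  refine ⟨?_, by rw [Matrix.det_mul, hP.2, hQ.2, one_mul]⟩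
  rw [Matrix.transpose_mul, Matrix.mul_assoc, ← Matrix.mul_assoc Pᵀ, hP.1, Matrix.one_mul, hQ.1]

theorem SO.transpose_mem {n : ℕ} {P : Matrix (Fin n) (Fin n) ℝ} (hP : P ∈ SO n) : Pᵀ ∈ SO n := by
  refine ⟨?_, by rw [Matrix.det_transpose, hP.2]⟩
  rw [Matrix.transpose_transpose]
  exact mul_eq_one_comm.mp hP.1

theorem exists_eq_rot_of_mem_SO {R : Matrix (Fin 2) (Fin 2) ℝ} (hR : R ∈ SO 2) :
    ∃ α, R = rot α := by
  obtain ⟨h, hdet⟩ := hR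
  have h00 := congrFun₂ h 0 0
  have h01 := congrFun₂ h 0 1
  have h11 := congrFun₂ h 1 1
  simp only [Matrix.mul_apply, Fin.sum_univ_two, Matrix.transpose_apply, Matrix.one_apply_eq,
    Matrix.one_apply_ne zero_ne_one] at h00 h01 h11
  rw [Matrix.det_fin_two] at hdet
  have hd : R 1 1 = R 0 0 := by
    linear_combination R 0 0 * hdet - R 1 1 * h00 + R 1 0 * h01
  have hb : R 0 1 = -R 1 0 := by
    linear_combination -R 1 0 * hdet - R 0 1 * h00 + R 0 0 * h01
  have hnorm : ‖(⟨R 0 0, R 1 0⟩ : ℂ)‖ = 1 := by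
    rw [Complex.norm_def, Complex.normSq_mk, h00, Real.sqrt_one]
  have hne : (⟨R 0 0, R 1 0⟩ : ℂ) ≠ 0 := norm_ne_zero_iff.mp (hnorm ▸ one_ne_zero)
  refine ⟨Complex.arg ⟨R 0 0, R 1 0⟩, ?_⟩
  have hc := Complex.cos_arg hne
  have hs := Complex.sin_arg (⟨R 0 0, R 1 0⟩ : ℂ)
  rw [hnorm, div_one] at hc hs
  rw [rot, hc, hs, ← hb]
  nth_rewrite 3 [← hd]
  exact Matrix.eta_fin_two R

theorem mem_SO_two_iff_exists_mul_rot {P : Matrix (Fin 2) (Fin 2) ℝ} (hP : P ∈ SO 2)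
    (R : Matrix (Fin 2) (Fin 2) ℝ) : R ∈ SO 2 ↔ ∃ α, R = P * rot α := by
  constructor
  · intro hR
    obtain ⟨α, hα⟩ := exists_eq_rot_of_mem_SO (SO.mul_mem (SO.transpose_mem hP) hR)
    refine ⟨α, ?_⟩
    rw [← hα, ← Matrix.mul_assoc, mul_eq_one_comm.mp hP.1, Matrix.one_mul]
  · rintro ⟨α, rfl⟩
    exact SO.mul_mem hP (rot_mem_SO α)

theorem polar_mem_SO {n : ℕ} {F U : Matrix (Fin n) (Fin n) ℝ} (hF : 0 < F.det) (hU : U.PosDef)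
    (hUsq : U * U = Fᵀ * F) : F * U⁻¹ ∈ SO n := by
  have hdet : IsUnit U.det := hU.det_pos.ne'.isUnit
  have hsymm : Uᵀ = U := by simpa [Matrix.conjTranspose_eq_transpose_of_trivial] using hU.1.eq
  refine ⟨?_, ?_⟩
  · rw [Matrix.transpose_mul, Matrix.transpose_nonsing_inv, hsymm, Matrix.mul_assoc,
      ← Matrix.mul_assoc Fᵀ, ← hUsq, Matrix.mul_assoc, Matrix.mul_nonsing_inv _ hdet,
      Matrix.mul_one, Matrix.nonsing_inv_mul _ hdet]
  · have hsq : U.det * U.det = F.det * F.det := by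
      simpa [Matrix.det_mul] using congrArg Matrix.det hUsq
    have heq : F.det = U.det := ((mul_self_inj hU.det_pos.le hF.le).mp hsq).symm
    rw [Matrix.det_mul, heq, ← Matrix.det_mul, Matrix.mul_nonsing_inv _ hdet, Matrix.det_one]

/-- For a fixed stretch `U`, the energy depends on the relative rotation `rot α` only through
the square of `cos α * tr U - ρ`. -/
theorem W_mul_rot {P U : Matrix (Fin 2) (Fin 2) ℝ} (hP : P ∈ SO 2) (hU : Uᵀ = U) {μ μc : ℝ}
    (hμ : μ ≠ μc) (α : ℝ) :
    W μ μc (P * rot α) (P * U) =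
      (μ - μc) / 2 * (Real.cos α * U.trace - 2 * μ / (μ - μc)) ^ 2 +
        (μ * (frobSq U + 2) - (μ - μc) / 2 * U.trace ^ 2 - 2 * μ ^ 2 / (μ - μc)) := by
  have hX : (P * rot α)ᵀ * (P * U) = (rot α)ᵀ * U := by
    rw [Matrix.transpose_mul, Matrix.mul_assoc, ← Matrix.mul_assoc Pᵀ, hP.1, Matrix.one_mul]
  have h01 : U 1 0 = U 0 1 := congrFun₂ hU 0 1
  have hne : μ - μc ≠ 0 := sub_ne_zero.mpr hμ
  rw [W, hX]
  simp only [frobSq, symPart, skewPart, rot, Matrix.trace_fin_two, Matrix.mul_apply,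
    Fin.sum_univ_two, Matrix.transpose_apply, Matrix.smul_apply, Matrix.add_apply,
    Matrix.sub_apply, Matrix.one_apply_eq, Matrix.one_apply_ne zero_ne_one,
    Matrix.one_apply_ne one_ne_zero, Matrix.of_apply, Matrix.cons_val', Matrix.cons_val_zero,
    Matrix.cons_val_one, Matrix.cons_val_fin_one, smul_eq_mul, h01]
  have hs : Real.sin α ^ 2 = 1 - Real.cos α ^ 2 := Real.sin_sq α
  field_simp
  ring_nf
  simp only [hs]
  ring

theorem minimizers_eq {P U : Matrix (Fin 2) (Fin 2) ℝ} (hP : P ∈ SO 2) (hU : Uᵀ = U) {μ μc : ℝ}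
    (hμ : μc < μ) :
    {R ∈ SO 2 | ∀ R' ∈ SO 2, W μ μc R (P * U) ≤ W μ μc R' (P * U)} =
      (fun α ↦ P * rot α) '' {α | ∀ α', (Real.cos α * U.trace - 2 * μ / (μ - μc)) ^ 2 ≤
        (Real.cos α' * U.trace - 2 * μ / (μ - μc)) ^ 2} := by
  have hle (α α' : ℝ) : W μ μc (P * rot α) (P * U) ≤ W μ μc (P * rot α') (P * U) ↔
      (Real.cos α * U.trace - 2 * μ / (μ - μc)) ^ 2 ≤
        (Real.cos α' * U.trace - 2 * μ / (μ - μc)) ^ 2 := by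
    rw [W_mul_rot hP hU hμ.ne', W_mul_rot hP hU hμ.ne', add_le_add_iff_right,
      mul_le_mul_iff_right₀ (by linarith)]
  ext R
  simp only [Set.mem_ofPred_eq, Set.mem_image]
  constructor
  · rintro ⟨hR, hmin⟩
    obtain ⟨α, rfl⟩ := (mem_SO_two_iff_exists_mul_rot hP R).mp hR
    exact ⟨α, fun α' ↦ (hle α α').mp (hmin _ (SO.mul_mem hP (rot_mem_SO α'))), rfl⟩
  · rintro ⟨α, hα, rfl⟩
    refine ⟨SO.mul_mem hP (rot_mem_SO α), fun R' hR' ↦ ?_⟩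
    obtain ⟨α', rfl⟩ := (mem_SO_two_iff_exists_mul_rot hP R').mp hR'
    exact (hle α α').mpr (hα α')

theorem rot_eq_one_of_cos_eq_one {α : ℝ} (h : Real.cos α = 1) : rot α = 1 := by
  have hs : Real.sin α = 0 := by
    have := Real.sin_sq_add_cos_sq α
    rw [h] at this
    nlinarith
  simp [rot, h, hs, Matrix.one_fin_two]

theorem rot_eq_or_eq_neg_of_cos_eq {α β : ℝ} (h : Real.cos α = Real.cos β) :
    rot α = rot β ∨ rot α = rot (-β) := by
  have hs : Real.sin α ^ 2 = Real.sin β ^ 2 := by rw [Real.sin_sq, Real.sin_sq, h]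
  rcases sq_eq_sq_iff_eq_or_eq_neg.mp hs with hs | hs
  · left
    simp [rot, h, hs]
  · right
    simp [rot, h, hs]

theorem image_mul_rot_minimizers_of_lt (P : Matrix (Fin 2) (Fin 2) ℝ) {T ρ : ℝ} (hT : 0 < T)
    (hρ : T < ρ) :
    (fun α ↦ P * rot α) '' {α | ∀ α', (Real.cos α * T - ρ) ^ 2 ≤ (Real.cos α' * T - ρ) ^ 2} =
      {P} := by
  ext R
  simp only [Set.mem_image, Set.mem_ofPred_eq, Set.mem_singleton_iff]
  constructor
  · rintro ⟨α, hα, rfl⟩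
    have h0 := hα 0
    rw [Real.cos_zero, one_mul] at h0
    have hcos : Real.cos α = 1 := by
      refine le_antisymm (Real.cos_le_one α) ?_
      by_contra! hlt
      nlinarith [mul_lt_mul_of_pos_right hlt hT]
    rw [rot_eq_one_of_cos_eq_one hcos, Matrix.mul_one]
  · rintro rfl
    refine ⟨0, fun α' ↦ ?_, by rw [rot_eq_one_of_cos_eq_one Real.cos_zero, Matrix.mul_one]⟩
    have := mul_le_mul_of_nonneg_right (Real.cos_le_one α') hT.le
    rw [Real.cos_zero]
    nlinarith

theorem image_mul_rot_minimizers_of_le (P : Matrix (Fin 2) (Fin 2) ℝ) {T ρ : ℝ} (hρ : 0 < ρ)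
    (hT : ρ ≤ T) :
    (fun α ↦ P * rot α) '' {α | ∀ α', (Real.cos α * T - ρ) ^ 2 ≤ (Real.cos α' * T - ρ) ^ 2} =
      {P * rot (Real.arccos (ρ / T)), P * rot (-Real.arccos (ρ / T))} := by
  have hT0 : 0 < T := hρ.trans_le hT
  have hcosβ : Real.cos (Real.arccos (ρ / T)) = ρ / T :=
    Real.cos_arccos (by linarith [div_pos hρ hT0]) ((div_le_one hT0).mpr hT)
  have hzero : Real.cos (Real.arccos (ρ / T)) * T - ρ = 0 := by
    rw [hcosβ, div_mul_cancel₀ _ hT0.ne', sub_self]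
  ext R
  simp only [Set.mem_image, Set.mem_ofPred_eq, Set.mem_insert_iff, Set.mem_singleton_iff]
  constructor
  · rintro ⟨α, hα, rfl⟩
    have h0 := hα (Real.arccos (ρ / T))
    rw [hzero] at h0
    have hα0 : Real.cos α * T - ρ = 0 := by nlinarith
    have hcos : Real.cos α = Real.cos (Real.arccos (ρ / T)) := by
      rw [hcosβ, eq_div_iff hT0.ne']
      linarith
    exact (rot_eq_or_eq_neg_of_cos_eq hcos).imp (congrArg (P * ·)) (congrArg (P * ·))
  · rintro (rfl | rfl)
    · refine ⟨_, fun α' ↦ ?_, rfl⟩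
      rw [hzero]
      nlinarith [sq_nonneg (Real.cos α' * T - ρ)]
    · refine ⟨_, fun α' ↦ ?_, rfl⟩
      rw [Real.cos_neg, hzero]
      nlinarith [sq_nonneg (Real.cos α' * T - ρ)]

/-- **Optimal planar Cosserat rotations for general non-classical parameters
μ > μc ≥ 0.** With ρ = 2μ/(μ−μc): if tr U(F) < ρ the unique minimizer of
W_{μ,μc}(·;F) over SO(2) is polar(F); if tr U(F) ≥ ρ the minimizers are
polar(F)·R(±β) with β = arccos(ρ/tr U(F)). -/
theorem optimal_rotations_general (F : Matrix (Fin 2) (Fin 2) ℝ) (hF : 0 < F.det)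
    (U : Matrix (Fin 2) (Fin 2) ℝ) (hUpos : U.PosDef) (hUsq : U * U = Fᵀ * F)
    (μ μc : ℝ) (hμc : 0 ≤ μc) (hμ : μc < μ) :
    (Matrix.trace U < 2 * μ / (μ - μc) →
      {R ∈ SO 2 | ∀ R' ∈ SO 2, W μ μc R F ≤ W μ μc R' F} = {F * U⁻¹}) ∧
    (2 * μ / (μ - μc) ≤ Matrix.trace U →
      {R ∈ SO 2 | ∀ R' ∈ SO 2, W μ μc R F ≤ W μ μc R' F} =
        {(F * U⁻¹) * rot (Real.arccos ((2 * μ / (μ - μc)) / Matrix.trace U)),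
         (F * U⁻¹) * rot (-Real.arccos ((2 * μ / (μ - μc)) / Matrix.trace U))}) := by
  have hP := polar_mem_SO hF hUpos hUsq
  have hsymm : Uᵀ = U := by simpa [Matrix.conjTranspose_eq_transpose_of_trivial] using hUpos.1.eq
  have hFU : (F * U⁻¹) * U = F := by
    rw [Matrix.mul_assoc, Matrix.nonsing_inv_mul _ hUpos.det_pos.ne'.isUnit, Matrix.mul_one]
  have hmin := minimizers_eq hP hsymm hμ
  rw [hFU] at hmin
  rw [hmin]
  exact ⟨image_mul_rot_minimizers_of_lt _ hUpos.trace_pos,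
    image_mul_rot_minimizers_of_le _ (div_pos (by linarith) (sub_pos.mpr hμ))⟩
end
end

section
/- (Energy level of the non-classical branch.) Let F ∈ GL⁺(2) and let R ∈ SO(2) satisfy tr(RᵀF) = 2. Then W_{1,0}(R;F) = ‖sym(RᵀF − 𝟙)‖² = (1/2)‖F‖² − det F. -/
open Matrix Real

noncomputable section

/-- The squared Frobenius norm is invariant under left multiplication by a matrix whose transpose
is a left inverse. -/
lemma frobSq_transpose_mul {n : ℕ} {R : Matrix (Fin n) (Fin n) ℝ} (hR : Rᵀ * R = 1)
    (F : Matrix (Fin n) (Fin n) ℝ) : frobSq (Rᵀ * F) = frobSq F := by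
  have hR' : R * Rᵀ = 1 := mul_eq_one_comm.mp hR
  rw [frobSq, frobSq, transpose_mul, transpose_transpose, Matrix.mul_assoc,
    ← Matrix.mul_assoc R, hR', Matrix.one_mul]

/-- The symmetric energy of a planar matrix of trace `2`. -/
lemma frobSq_symPart_sub_one_of_trace_eq_two {U : Matrix (Fin 2) (Fin 2) ℝ} (hU : U.trace = 2) :
    frobSq (symPart (U - 1)) = (1 / 2) * frobSq U - U.det := by
  rw [trace_fin_two] at hU
  simp only [frobSq, symPart, trace_fin_two, det_fin_two, Matrix.mul_apply, Fin.sum_univ_two,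
    transpose_apply, Matrix.smul_apply, Matrix.add_apply, Matrix.sub_apply, Matrix.one_apply_eq,
    smul_eq_mul, ne_eq, zero_ne_one, one_ne_zero, not_false_eq_true, Matrix.one_apply_ne]
  have h : U 1 1 = 2 - U 0 0 := by linarith
  rw [h]
  ring

/-- **Energy level of the non-classical branch.** If R ∈ SO(2) satisfies
tr(RᵀF) = 2 then W_{1,0}(R;F) = (1/2)‖F‖² − det F. -/
theorem nonclassical_energy_level (F : Matrix (Fin 2) (Fin 2) ℝ) (hF : 0 < F.det)
    (R : Matrix (Fin 2) (Fin 2) ℝ) (hR : R ∈ SO 2)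
    (htr : Matrix.trace (Rᵀ * F) = 2) :
    W 1 0 R F = (1 / 2) * frobSq F - F.det ∧
    frobSq (symPart (Rᵀ * F - 1)) = (1 / 2) * frobSq F - F.det := by
  have key : frobSq (symPart (Rᵀ * F - 1)) = (1 / 2) * frobSq F - F.det := by
    rw [frobSq_symPart_sub_one_of_trace_eq_two htr, frobSq_transpose_mul hR.1, det_mul,
      det_transpose, hR.2, one_mul]
  exact ⟨by rw [W, key, one_mul, zero_mul, add_zero], key⟩
end
end
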